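/- For every n ≥ 1 and every nonzero vector p ∈ ℂ^{n+1}, the space {A ∈ Sym_{n+1}(ℂ) : det A ≠ 0 and pᵀAp ≠ 0}/ℂˣ (the space Qu₀(n) of nonsingular quadrics in ℂPⁿ with the geometric hyperplane H_p removed) is path-connected and its fundamental group at any basepoint is isomorphic to ℤ. -/

import Mathlib

open Matrix

/-- The setoid identifying proportional matrices (quotient by the scaling action of `ℂˣ`)
on the subtype of matrices satisfying a property `P`. -/
def scalingSetoid (N : ℕ) (P : Matrix (Fin N) (Fin N) ℂ → Prop) :
    Setoid {A : Matrix (Fin N) (Fin N) ℂ // P A} where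
  r A B := ∃ c : ℂˣ, (B : Matrix (Fin N) (Fin N) ℂ) = (c : ℂ) • (A : Matrix (Fin N) (Fin N) ℂ)
  iseqv := by
    constructor
    · intro A; exact ⟨1, by simp⟩
    · rintro A B ⟨c, h⟩
      refine ⟨c⁻¹, ?_⟩
      rw [h, smul_smul]
      norm_cast
      simp
    · rintro A B C ⟨c, h⟩ ⟨d, h'⟩
      refine ⟨d * c, ?_⟩
      rw [h', h, smul_smul]
      norm_cast

/-- The quotient (with the quotient topology) of the space of matrices satisfying `P`
by the scaling action of `ℂˣ`. -/
abbrev MatQuot (N : ℕ) (P : Matrix (Fin N) (Fin N) ℂ → Prop) : Type :=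
  Quotient (scalingSetoid N P)

set_option linter.unusedSectionVars false

section Helpers

open scoped unitInterval

/-- Free homotopy of closed loops inside a set `S`. -/
def FH {Y : Type*} [TopologicalSpace Y] (S : Set Y) (f g : C(I, Y)) : Prop :=
  ContinuousMap.HomotopicWith f g (fun h => (∀ t, h t ∈ S) ∧ h 0 = h 1)

namespace FH
variable {Y : Type*} [TopologicalSpace Y] {S : Set Y} {f g h : C(I, Y)}

theorem of (H : I × I → Y) (hc : Continuous H) (hm : ∀ s t, H (s, t) ∈ S)
    (hcl : ∀ s, H (s, 0) = H (s, 1)) (h0 : ∀ t, H (0, t) = f t) (h1 : ∀ t, H (1, t) = g t) :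
    FH S f g :=
  ⟨{ toFun := H
     continuous_toFun := hc
     map_zero_left := h0
     map_one_left := h1
     prop' := fun s => ⟨fun t => hm s t, hcl s⟩ }⟩

theorem exists_map (F : FH S f g) : ∃ H : I × I → Y, Continuous H ∧ (∀ s t, H (s, t) ∈ S) ∧
    (∀ s, H (s, 0) = H (s, 1)) ∧ (∀ t, H (0, t) = f t) ∧ (∀ t, H (1, t) = g t) := by
  obtain ⟨H⟩ := F
  exact ⟨H, H.continuous, fun s t => (H.prop s).1 t, fun s => (H.prop s).2,
    H.apply_zero, H.apply_one⟩

theorem refl (hm : ∀ t, f t ∈ S) (hcl : f 0 = f 1) : FH S f f :=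
  ContinuousMap.HomotopicWith.refl f ⟨hm, hcl⟩

theorem trans (F : FH S f g) (G : FH S g h) : FH S f h :=
  ContinuousMap.HomotopicWith.trans F G

theorem mem_right (F : FH S f g) (t : I) : g t ∈ S := by
  obtain ⟨H, -, h1, -, -, h2⟩ := F.exists_map
  rw [← h2]; exact h1 _ _

theorem closed_right (F : FH S f g) : g 0 = g 1 := by
  obtain ⟨H, -, -, h1, -, h2⟩ := F.exists_map
  rw [← h2, ← h2]; exact h1 _
end FH

theorem exists_nonvanishing (a : C(I, ℂ)) (ha : a 0 = a 1) (ε : ℝ) (hε : 0 < ε) :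
    ∃ b : C(I, ℂ), b 0 = b 1 ∧ (∀ t, b t ≠ 0) ∧ ∀ t, ‖b t - a t‖ < ε := by
  have e8 : 0 < ε / 8 := by positivity
  obtain ⟨p, hp⟩ := exists_polynomial_near_continuousMap 0 1
    (⟨fun t => (a t).re, by fun_prop⟩ : C(I, ℝ)) (ε / 8) e8
  obtain ⟨q, hq⟩ := exists_polynomial_near_continuousMap 0 1
    (⟨fun t => (a t).im, by fun_prop⟩ : C(I, ℝ)) (ε / 8) e8
  rw [ContinuousMap.norm_lt_iff _ e8] at hp hq
  let r : ℝ → ℂ := fun t => ((p.eval t : ℝ) : ℂ) + ((q.eval t : ℝ) : ℂ) * Complex.I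
  have hr : ContDiff ℝ 1 r := by
    have h1 : ContDiff ℝ 1 (fun t : ℝ => p.eval t) := by
      have h := Polynomial.contDiff_aeval (𝕜 := ℝ) p 1
      simp only [Polynomial.coe_aeval_eq_eval] at h
      exact h
    have h2 : ContDiff ℝ 1 (fun t : ℝ => q.eval t) := by
      have h := Polynomial.contDiff_aeval (𝕜 := ℝ) q 1
      simp only [Polynomial.coe_aeval_eq_eval] at h
      exact h
    exact (Complex.ofRealCLM.contDiff.comp h1).add
      ((Complex.ofRealCLM.contDiff.comp h2).mul contDiff_const)
  have hra : ∀ t : I, ‖r t - a t‖ < ε / 4 := by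
    intro t
    have h1 := hp t
    have h2 := hq t
    simp only [ContinuousMap.sub_apply, Polynomial.toContinuousMapOn_apply,
      Polynomial.toContinuousMap_apply, ContinuousMap.coe_mk, Real.norm_eq_abs] at h1 h2
    have h3 := Complex.norm_le_abs_re_add_abs_im (r t - a t)
    have h4 : (r t - a t).re = p.eval (t : ℝ) - (a t).re := by simp [r]
    have h5 : (r t - a t).im = q.eval (t : ℝ) - (a t).im := by simp [r]
    rw [h4, h5] at h3
    linarith
  let u : ℝ → ℂ := fun t => r t - (t : ℂ) * (r 1 - r 0)
  have hu : ContDiff ℝ 1 u :=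
    hr.sub (Complex.ofRealCLM.contDiff.mul contDiff_const)
  have hd : Dense (Set.range u)ᶜ := hu.dense_compl_range_of_finrank_lt_finrank (by simp)
  obtain ⟨w, hw, hw2⟩ := Metric.dense_iff.1 hd 0 (ε / 4) (by positivity)
  have hw' : ‖w‖ < ε / 4 := by simpa using hw
  refine ⟨⟨fun t => u t - w, by have := hu.continuous; fun_prop⟩, ?_, ?_, ?_⟩
  · simp [u]
  · intro t h
    exact hw2 ⟨t, sub_eq_zero.1 h⟩
  · intro t
    have h0 := hra 0
    have h1 := hra 1
    have ht := hra t
    have e : u t - w - a t = (r t - a t) - (t : ℂ) * ((r (1 : I) - a 1) - (r (0 : I) - a 0)) - w := by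
      simp only [u, ha]; simp; ring
    have hb : ‖(t : ℂ) * ((r (1 : I) - a 1) - (r (0 : I) - a 0))‖ ≤ ε / 4 + ε / 4 := by
      rw [norm_mul]
      have : ‖((t : ℝ) : ℂ)‖ ≤ 1 := by
        rw [Complex.norm_real, Real.norm_eq_abs, abs_of_nonneg t.2.1]; exact t.2.2
      have h2 := norm_sub_le (r (1 : I) - a 1) (r (0 : I) - a 0)
      calc _ ≤ 1 * ‖(r (1 : I) - a 1) - (r (0 : I) - a 0)‖ := by gcongr
        _ ≤ _ := by linarith
    simp only [ContinuousMap.coe_mk]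
    rw [e]
    have h3 := norm_sub_le ((r t - a t) - (t : ℂ) * ((r (1 : I) - a 1) - (r (0 : I) - a 0))) w
    have h4 := norm_sub_le (r t - a t) ((t : ℂ) * ((r (1 : I) - a 1) - (r (0 : I) - a 0)))
    linarith

variable {m : Type*} [Fintype m] [DecidableEq m]

/-- Nonsingular symmetric matrices with normalized entry at `(o, o)`. -/
def NS (o : m) : Set (Matrix m m ℂ) := {A | A.IsSymm ∧ A.det ≠ 0 ∧ A o o = 1}

theorem perturb (o k : m) (hk : k ≠ o) (A : C(I, Matrix m m ℂ)) (hA : ∀ t, A t ∈ NS o)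
    (hcl : A 0 = A 1) :
    ∃ B : C(I, Matrix m m ℂ), FH (NS o) A B ∧ (∀ t, B t k k ≠ 0) ∧
      ∀ t i j, ¬ (i = k ∧ j = k) → B t i j = A t i j := by
  have hcA : Continuous A := A.continuous
  have ev : ∀ᶠ w : ℂ in nhds 0, ∀ t ∈ (Set.univ : Set I), (A t + single k k w).det ≠ 0 := by
    apply isCompact_univ.eventually_forall_of_forall_eventually
    intro t _
    have hc : Continuous fun z : ℂ × I => (A z.2 + single k k z.1).det := by
      refine Continuous.matrix_det ?_
      refine (hcA.comp continuous_snd).add ?_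
      refine continuous_matrix fun i j => ?_
      simp only [single_apply]
      split_ifs <;> fun_prop
    refine (hc.continuousAt (x := (0, t))).eventually_ne ?_
    simpa using (hA t).2.1
  obtain ⟨ε, hε, hball⟩ := Metric.eventually_nhds_iff.1 ev
  obtain ⟨b, hb1, hb2, hb3⟩ := exists_nonvanishing ⟨fun t => A t k k, by fun_prop⟩
    (by simp [hcl]) ε hε
  have hcb : Continuous b := b.continuous
  simp only [ContinuousMap.coe_mk] at hb3
  let H : I × I → Matrix m m ℂ := fun z =>
    A z.2 + single k k (((z.1 : ℝ) : ℂ) * (b z.2 - A z.2 k k))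
  have hH : Continuous H := by
    refine (hcA.comp continuous_snd).add ?_
    refine continuous_matrix fun i j => ?_
    simp only [single_apply]
    split_ifs <;> fun_prop
  refine ⟨⟨fun t => H (1, t), by fun_prop⟩, FH.of H hH ?_ ?_ ?_ ?_, ?_, ?_⟩
  · intro s t
    refine ⟨?_, ?_, ?_⟩
    · apply IsSymm.add (hA t).1
      simp [IsSymm]
    · refine hball ?_ t trivial
      rw [dist_zero_right, norm_mul]
      have : ‖((s : ℝ) : ℂ)‖ ≤ 1 := by
        rw [Complex.norm_real, Real.norm_eq_abs, abs_of_nonneg s.2.1]; exact s.2.2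
      calc _ ≤ 1 * ‖b t - A t k k‖ := by gcongr
        _ < ε := by rw [one_mul]; exact hb3 t
    · simp [H, hk, (hA t).2.2]
  · intro s; simp [H, hcl, hb1]
  · intro t; simp [H]
  · intro t; rfl
  · intro t; simpa [H] using hb2 t
  · intro t i j hij
    have : ¬ (k = i ∧ k = j) := fun h => hij ⟨h.1.symm, h.2.symm⟩
    simp [H, this]

/-- elementary congruence -/
def elimMat (k : m) (c : m → ℂ) : Matrix m m ℂ := 1 - vecMulVec c (Pi.single k 1)

theorem elimMat_det (k : m) (c : m → ℂ) (hc : c k = 0) : (elimMat k c).det = 1 := by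
  have := Matrix.det_one_add_replicateCol_mul_replicateRow (ι := Unit) (-c) (Pi.single k (1 : ℂ))
  rw [elimMat, sub_eq_add_neg, ← neg_vecMulVec, vecMulVec_eq Unit, this]
  simp [hc]

theorem elimMat_apply (k : m) (c : m → ℂ) (A : Matrix m m ℂ) (i j : m) :
    (elimMat k c * A * (elimMat k c)ᵀ) i j =
      A i j - c i * A k j - c j * A i k + c i * c j * A k k := by
  have h1 : ∀ i j, (elimMat k c * A) i j = A i j - c i * A k j := by
    intro i j
    rw [elimMat, sub_mul, one_mul, vecMulVec_mul]
    simp [vecMulVec_apply]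
  have h2 : ∀ (B : Matrix m m ℂ) i j, (B * (elimMat k c)ᵀ) i j = B i j - c j * B i k := by
    intro B i j
    rw [elimMat, transpose_sub, mul_sub, transpose_one, mul_one, transpose_vecMulVec, mul_vecMulVec]
    simp [vecMulVec_apply, mul_comm]
  rw [h2, h1, h1]; ring

theorem clearCol (o k : m) (A : C(I, Matrix m m ℂ)) (hA : ∀ t, A t ∈ NS o)
    (hcl : A 0 = A 1) (hk : ∀ t, A t k k ≠ 0) (ho : o = k ∨ ∀ t, A t o k = 0) :
    ∃ B : C(I, Matrix m m ℂ), FH (NS o) A B ∧ (∀ t i, i ≠ k → B t k i = 0) ∧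
      ∀ t i, (∀ j, j ≠ i → A t i j = 0) → ∀ j, j ≠ i → B t i j = 0 := by
  have hcA : Continuous A := A.continuous
  let c : I × I → m → ℂ := fun z i => if i = k then 0 else ((z.1 : ℝ) : ℂ) * (A z.2 i k / A z.2 k k)
  have hck : ∀ z, c z k = 0 := fun z => by simp [c]
  have hc : ∀ i, Continuous fun z => c z i := by
    intro i
    simp only [c]
    split_ifs
    · fun_prop
    · refine Continuous.mul (by fun_prop) (Continuous.div (by fun_prop) (by fun_prop) fun z => hk _)
  let H : I × I → Matrix m m ℂ := fun z => elimMat k (c z) * A z.2 * (elimMat k (c z))ᵀ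
  have hH : Continuous H := by
    refine continuous_matrix fun i j => ?_
    simp only [H, elimMat_apply]
    have := hc i
    have := hc j
    fun_prop
  have hrow : ∀ t i, i ≠ k → H (1, t) k i = 0 := by
    intro t i hi
    simp only [H, elimMat_apply, hck]
    have := hk t
    have h2 : A t k i = A t i k := (hA t).1.apply _ _
    simp only [c, hi, if_false, h2]
    simp; field_simp; ring
  refine ⟨⟨fun t => H (1, t), by fun_prop⟩, FH.of H hH ?_ ?_ ?_ ?_, ?_, ?_⟩
  · intro s t
    refine ⟨?_, ?_, ?_⟩
    · have := (hA t).1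
      simp only [H, IsSymm, transpose_mul, transpose_transpose, this.eq, Matrix.mul_assoc]
    · simp only [H, det_mul, det_transpose, elimMat_det _ _ (hck _)]
      simpa using (hA t).2.1
    · have : c (s, t) o = 0 := by
        rcases ho with rfl | ho
        · exact hck _
        · simp [c, ho]
      simp only [H, elimMat_apply, this]
      simp [(hA t).2.2]
  · intro s
    have : c (s, 0) = c (s, 1) := by simp [c, hcl]
    simp [H, hcl, this]
  · intro t
    ext i j
    simp [H, elimMat_apply, c]
  · intro t; rfl
  · intro t i hi
    exact hrow t i hi
  · intro t i hi j hj
    by_cases hik : i = k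
    · subst hik; exact hrow t j hj
    · have h1 : A t i k = 0 := hi k (Ne.symm hik)
      have h2 : c (1, t) i = 0 := by simp [c, h1]
      simp [H, elimMat_apply, h2, h1, hi j hj]

theorem diagonalize (o : m) (A : C(I, Matrix m m ℂ)) (hA : ∀ t, A t ∈ NS o)
    (hcl : A 0 = A 1) (s : Finset m) :
    ∃ B : C(I, Matrix m m ℂ), FH (NS o) A B ∧ ∀ t i, (i = o ∨ i ∈ s) → ∀ j, j ≠ i → B t i j = 0 := by
  induction s using Finset.induction_on with
  | empty =>
    obtain ⟨B, h1, h2, h3⟩ := clearCol o o A hA hcl (fun t => by simp [(hA t).2.2]) (Or.inl rfl)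
    refine ⟨B, h1, ?_⟩
    rintro t i (rfl | h) j hj
    · exact h2 t j hj
    · simp at h
  | insert k s hks ih =>
    obtain ⟨B, hB, hB2⟩ := ih
    by_cases hko : k = o
    · subst hko
      refine ⟨B, hB, ?_⟩
      intro t i hi
      apply hB2
      simpa using hi
    · obtain ⟨C, hC1, hC2, hC3⟩ := perturb o k hko B hB.mem_right hB.closed_right
      have hC4 : ∀ t i, (i = o ∨ i ∈ s) → ∀ j, j ≠ i → C t i j = 0 := by
        intro t i hi j hj
        rw [hC3 t i j (fun h => hj (h.2.trans h.1.symm))]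
        exact hB2 t i hi j hj
      obtain ⟨D, hD1, hD2, hD3⟩ := clearCol o k C hC1.mem_right hC1.closed_right hC2
        (Or.inr fun t => hC4 t o (Or.inl rfl) k hko)
      refine ⟨D, hB.trans (hC1.trans hD1), ?_⟩
      intro t i hi j hj
      by_cases hik : i = k
      · subst hik; exact hD2 t j hj
      · apply hD3 t i _ j hj
        apply hC4 t i
        simpa [hik] using hi

theorem diagonalize_all (o : m) (A : C(I, Matrix m m ℂ)) (hA : ∀ t, A t ∈ NS o)
    (hcl : A 0 = A 1) :
    ∃ B : C(I, Matrix m m ℂ), FH (NS o) A B ∧ ∀ t i j, i ≠ j → B t i j = 0 := by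
  obtain ⟨B, h1, h2⟩ := diagonalize o A hA hcl Finset.univ
  exact ⟨B, h1, fun t i j hij => h2 t i (Or.inr (Finset.mem_univ _)) j hij.symm⟩


/-- good diagonal loops -/
def DG (o : m) (d : C(I, m → ℂ)) : Prop :=
  (∀ t i, d t i ≠ 0) ∧ d 0 = d 1 ∧ ∀ t, d t o = 1

/-- the loop of diagonal matrices -/
noncomputable def dg (d : C(I, m → ℂ)) : C(I, Matrix m m ℂ) :=
  ⟨fun t => diagonal (d t), by fun_prop⟩

theorem dg_apply (d : C(I, m → ℂ)) (t : I) : dg d t = diagonal (d t) := rfl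

theorem diag_mem_NS (o : m) (d : m → ℂ) (h : ∀ i, d i ≠ 0) (ho : d o = 1) :
    diagonal d ∈ NS o := by
  refine ⟨isSymm_diagonal d, ?_, by simpa using ho⟩
  rw [det_diagonal]
  exact Finset.prod_ne_zero_iff.2 fun i _ => h i

theorem reparam (o j l : m) (hj : j ≠ o) (hl : l ≠ o) (hjl : j ≠ l) (d : C(I, m → ℂ))
    (hd : DG o d) :
    ∃ e : C(I, m → ℂ), DG o e ∧ FH (NS o) (dg d) (dg e) ∧ (∀ t, e t j = 1 ∨ e t l = 1) ∧
      ∀ t i, i ≠ j → i ≠ l → e t i = d t i := by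
  obtain ⟨hd1, hd2, hd3⟩ := hd
  have hcd : Continuous d := d.continuous
  let φ : I × I → I := fun z => Set.projIcc (0 : ℝ) 1 zero_le_one ((1 + (z.1 : ℝ)) * z.2)
  let ψ : I × I → I := fun z => Set.projIcc (0 : ℝ) 1 zero_le_one ((1 + (z.1 : ℝ)) * z.2 - z.1)
  have hφ : Continuous φ := continuous_projIcc.comp (by fun_prop)
  have hψ : Continuous ψ := continuous_projIcc.comp (by fun_prop)
  have φ0 : ∀ s, φ (s, 0) = 0 := fun s => Set.projIcc_of_le_left _ (by simp)
  have φ1 : ∀ s : I, φ (s, 1) = 1 := fun s =>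
    Set.projIcc_of_right_le _ (by have := s.2.1; simpa using this)
  have ψ0 : ∀ s : I, ψ (s, 0) = 0 := fun s =>
    Set.projIcc_of_le_left _ (by have := s.2.1; simpa using this)
  have ψ1 : ∀ s : I, ψ (s, 1) = 1 := fun s => Set.projIcc_of_right_le _ (by simp)
  have φs : ∀ t, φ (0, t) = t := fun t => by simp [φ]
  have ψs : ∀ t, ψ (0, t) = t := fun t => by simp [ψ]
  let H : I × I → m → ℂ := fun z i =>
    if i = j then d (φ z) j * Complex.exp (-(((z.1 : ℝ) : ℂ) * Complex.log (d 0 j)))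
    else if i = l then d (ψ z) l * Complex.exp (-(((z.1 : ℝ) : ℂ) * Complex.log (d 0 l)))
    else d z.2 i
  have hH : Continuous H := by
    refine continuous_pi fun i => ?_
    simp only [H]
    split_ifs <;> fun_prop
  have hHne : ∀ z i, H z i ≠ 0 := by
    intro z i
    simp only [H]
    split_ifs
    · exact mul_ne_zero (hd1 _ _) (Complex.exp_ne_zero _)
    · exact mul_ne_zero (hd1 _ _) (Complex.exp_ne_zero _)
    · exact hd1 _ _
  have hHcl : ∀ s, H (s, 0) = H (s, 1) := by
    intro s; ext i
    simp only [H, φ0, φ1, ψ0, ψ1, hd2]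
  have hHo : ∀ z, H z o = 1 := by
    intro z
    simp [H, hj.symm, hl.symm, hd3]
  refine ⟨⟨fun t => H (1, t), by fun_prop⟩, ⟨fun t i => hHne _ _, hHcl 1, fun t => hHo _⟩,
    FH.of (fun z => diagonal (H z)) (by fun_prop) ?_ ?_ ?_ ?_, ?_, ?_⟩
  · intro s t
    exact diag_mem_NS o _ (hHne _) (hHo _)
  · intro s; simp only [hHcl]
  · intro t
    rw [dg_apply]
    congr 1
    ext i
    simp only [H, φs, ψs]
    split_ifs with h1 h2
    · subst h1; simp
    · subst h2; simp
    · rfl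
  · intro t; rfl
  · intro t
    rcases le_total (1 / 2 : ℝ) t with ht | ht
    · left
      have : φ (1, t) = 1 := Set.projIcc_of_right_le _ (by simp; linarith)
      simp only [ContinuousMap.coe_mk, H, this, if_true, hd2, Complex.exp_neg]
      simp [Complex.exp_log (hd1 1 j), hd1]
    · right
      have : ψ (1, t) = 0 := Set.projIcc_of_le_left _ (by simp; linarith)
      simp only [ContinuousMap.coe_mk, H, this, if_true, hd2, Complex.exp_neg, hjl.symm, if_false]
      simp [Complex.exp_log (hd1 1 l), hd1]
  · intro t i hi hi'
    simp [H, hi, hi']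

theorem combine (o j l : m) (hj : j ≠ o) (hl : l ≠ o) (hjl : j ≠ l) (d : C(I, m → ℂ))
    (hd : DG o d) :
    ∃ e : C(I, m → ℂ), DG o e ∧ FH (NS o) (dg d) (dg e) ∧ (∀ t, e t j = 1) ∧
      ∀ t i, i ≠ j → i ≠ l → e t i = d t i := by
  obtain ⟨e, he, hF, h1, h2⟩ := reparam o j l hj hl hjl d hd
  obtain ⟨he1, he2, he3⟩ := he
  have hce : Continuous e := e.continuous
  let f : I → m → ℂ := fun t i => if i = j then 1 else if i = l then e t l + e t j - 1 else e t i
  have hf : Continuous f := by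
    refine continuous_pi fun i => ?_
    simp only [f]
    split_ifs <;> fun_prop
  let v : I → m → ℂ := fun s i =>
    if i = j then ((Real.cos (Real.pi / 2 * s) : ℝ) : ℂ)
    else if i = l then ((Real.sin (Real.pi / 2 * s) : ℝ) : ℂ) else 0
  have hv : ∀ i, Continuous fun s => v s i := by
    intro i
    simp only [v]
    split_ifs <;> fun_prop
  have hvv : ∀ s, v s ⬝ᵥ v s = 1 := by
    intro s
    have e1 : v s = Pi.single j ((Real.cos (Real.pi / 2 * s) : ℝ) : ℂ) +
        Pi.single l ((Real.sin (Real.pi / 2 * s) : ℝ) : ℂ) := by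
      ext i
      simp only [v, Pi.add_apply, Pi.single_apply]
      by_cases hij : i = j
      · subst hij; simp [hjl]
      · simp [hij]
    rw [e1]
    simp only [add_dotProduct, single_dotProduct, Pi.add_apply, Pi.single_apply, hjl, hjl.symm,
      if_true, if_false]
    norm_cast
    have := Real.cos_sq_add_sin_sq (Real.pi / 2 * s)
    simp only [add_zero, zero_add]
    rw [← this]; ring
  let g : I → m → ℂ := fun t i => if i = j then 1 else e t i
  have hg : ∀ t i, g t i ≠ 0 := by
    intro t i
    simp only [g]
    split_ifs
    · simp
    · exact he1 _ _
  have hgc : ∀ i, Continuous fun t => g t i := by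
    intro i
    simp only [g]
    split_ifs <;> fun_prop
  let H : I × I → Matrix m m ℂ := fun z =>
    diagonal (g z.2) + (e z.2 j - 1) • vecMulVec (v z.1) (v z.1)
  have hH : Continuous H := by
    refine continuous_matrix fun i k => ?_
    simp only [H, Matrix.add_apply, Matrix.smul_apply, vecMulVec_apply, diagonal_apply]
    have := hv i
    have := hv k
    have := hgc i
    split_ifs <;> fun_prop
  refine ⟨⟨f, hf⟩, ⟨?_, ?_, ?_⟩, hF.trans (FH.of H hH ?_ ?_ ?_ ?_), ?_, ?_⟩
  · intro t i
    simp only [ContinuousMap.coe_mk, f]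
    split_ifs
    · simp
    · rcases h1 t with h | h
      · simpa [h] using he1 t l
      · simpa [h] using he1 t j
    · exact he1 _ _
  · simp only [ContinuousMap.coe_mk, f, he2]
  · intro t
    simp [f, hj.symm, hl.symm, he3]
  · intro s t
    refine ⟨?_, ?_, ?_⟩
    · refine (isSymm_diagonal _).add (IsSymm.smul ?_ _)
      simp [IsSymm, transpose_vecMulVec]
    · have hdet : (diagonal (g t)).det ≠ 0 := by
        rw [det_diagonal]
        exact Finset.prod_ne_zero_iff.2 fun i _ => hg t i
      rcases h1 t with h | h
      · simpa [H, h] using hdet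
      · have e1 : H (s, t) = diagonal (g t) * (1 + vecMulVec ((e t j - 1) • v s) (v s)) := by
          rw [mul_add, mul_one, mul_vecMulVec]
          simp only [H]
          rw [← smul_vecMulVec]
          congr 2
          ext i
          simp only [mulVec_diagonal, Pi.smul_apply, smul_eq_mul, g, v]
          split_ifs with a b
          · ring
          · subst b; rw [h]; ring
          · ring
        rw [e1, det_mul, vecMulVec_eq Unit, det_one_add_replicateCol_mul_replicateRow,
          dotProduct_smul, hvv]
        refine mul_ne_zero hdet ?_
        simpa using he1 t j
    · simp [H, g, v, hj.symm, hl.symm, he3, vecMulVec_apply]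
  · intro s
    have : g 0 = g 1 := by simp only [g, he2]
    simp only [H, he2, this]
  · intro t
    rw [dg_apply]
    ext i k
    simp only [H, Matrix.add_apply, Matrix.smul_apply, vecMulVec_apply, diagonal_apply, g, v]
    by_cases hik : i = k
    · subst hik
      by_cases hij : i = j
      · subst hij; simp
      · simp [hij]
    · by_cases hij : i = j
      · subst hij; simp [hik, Ne.symm hik]
      · simp [hik, hij]
  · intro t
    rw [dg_apply]
    ext i k
    simp only [H, Matrix.add_apply, Matrix.smul_apply, vecMulVec_apply, diagonal_apply, g, v,
      ContinuousMap.coe_mk, f]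
    by_cases hik : i = k
    · subst hik
      by_cases hij : i = j
      · subst hij; simp
      · by_cases hil : i = l
        · subst hil; simp [hij]; ring
        · simp [hij, hil]
    · by_cases hij : i = j
      · subst hij; simp [hik]
      · by_cases hil : i = l
        · subst hil; simp [hik, hij, Ne.symm hik]
        · simp [hij, hil, hik]
  · intro t; simp [f]
  · intro t i hi hi'
    simp only [ContinuousMap.coe_mk, f, hi, hi', if_false]
    exact h2 t i hi hi'

theorem combine_all (o l : m) (hl : l ≠ o) (d : C(I, m → ℂ)) (hd : DG o d) (s : Finset m) :
    ∃ e : C(I, m → ℂ), DG o e ∧ FH (NS o) (dg d) (dg e) ∧ ∀ t, ∀ i ∈ s, i ≠ l → e t i = 1 := by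
  induction s using Finset.induction_on with
  | empty =>
    exact ⟨d, hd, FH.refl (fun t => diag_mem_NS o _ (hd.1 t) (hd.2.2 t))
      (by rw [dg_apply, dg_apply, hd.2.1]), by simp⟩
  | insert j s hjs ih =>
    obtain ⟨e, he, hF, h1⟩ := ih
    by_cases hjl : j = l
    · refine ⟨e, he, hF, fun t i hi hil => h1 t i ?_ hil⟩
      rcases Finset.mem_insert.1 hi with h | h
      · exact absurd (h.trans hjl) hil
      · exact h
    by_cases hjo : j = o
    · refine ⟨e, he, hF, fun t i hi hil => ?_⟩
      rcases Finset.mem_insert.1 hi with h | h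
      · rw [h, hjo]; exact he.2.2 t
      · exact h1 t i h hil
    obtain ⟨f, hf, hG, h2, h3⟩ := combine o j l hjo hl hjl e he
    refine ⟨f, hf, hF.trans hG, fun t i hi hil => ?_⟩
    by_cases hij : i = j
    · rw [hij]; exact h2 t
    · rw [h3 t i hij hil]
      exact h1 t i (Finset.mem_of_mem_insert_of_ne hi hij) hil

/-- diagonal with a single nontrivial entry -/
def sdiag (l : m) (z : ℂ) : Matrix m m ℂ := diagonal (fun i => if i = l then z else 1)

theorem sdiag_det (l : m) (z : ℂ) : (sdiag l z).det = z := by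
  simp [sdiag, det_diagonal, Finset.prod_ite_eq']

theorem continuous_sdiag (l : m) : Continuous (sdiag l : ℂ → Matrix m m ℂ) := by
  refine Continuous.matrix_diagonal (continuous_pi fun i => ?_)
  split_ifs <;> fun_prop

theorem sdiag_mem (o l : m) (hl : l ≠ o) (z : ℂ) (hz : z ≠ 0) : sdiag l z ∈ NS o := by
  refine ⟨isSymm_diagonal _, by rwa [sdiag_det], by simp [sdiag, hl.symm]⟩

theorem loop_normal_form (o l : m) (hl : l ≠ o) (A : C(I, Matrix m m ℂ)) (hA : ∀ t, A t ∈ NS o)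
    (hcl : A 0 = A 1) :
    FH (NS o) A ⟨fun t => sdiag l (A t).det,
      (continuous_sdiag l).comp (Continuous.matrix_det A.continuous)⟩ := by
  obtain ⟨B, hB, hB2⟩ := diagonalize_all o A hA hcl
  have hcB := B.continuous
  let d : C(I, m → ℂ) := ⟨fun t i => B t i i, by fun_prop⟩
  have hBd : B = dg d := by
    ext t i j
    rw [dg_apply, diagonal_apply]
    split_ifs with h
    · subst h; rfl
    · exact hB2 t i j h
  have hd : DG o d := by
    refine ⟨fun t i => ?_, ?_, fun t => (hB.mem_right t).2.2⟩
    · have := (hB.mem_right t).2.1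
      rw [hBd, dg_apply, det_diagonal] at this
      exact Finset.prod_ne_zero_iff.1 this i (Finset.mem_univ _)
    · ext i
      simp [d, hB.closed_right]
  obtain ⟨e, he, hF, h1⟩ := combine_all o l hl d hd Finset.univ
  have hAe : FH (NS o) A (dg e) := by
    rw [hBd] at hB; exact hB.trans hF
  have hes : ∀ t, dg e t = sdiag l (dg e t).det := by
    intro t
    have : dg e t = sdiag l (e t l) := by
      rw [dg_apply, sdiag]
      congr 1
      ext i
      split_ifs with h
      · rw [h]
      · exact h1 t i (Finset.mem_univ _) h
    rw [this, sdiag_det]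
  refine hAe.trans ?_
  obtain ⟨H, c1, c2, c3, c4, c5⟩ := hAe.exists_map
  refine ContinuousMap.HomotopicWith.symm (FH.of (fun z => sdiag l (H z).det)
    ((continuous_sdiag l).comp (Continuous.matrix_det c1)) ?_ ?_ ?_ ?_)
  · intro s t
    exact sdiag_mem o l hl _ (c2 s t).2.1
  · intro s; simp only [c3]
  · intro t; simp only [c4]; rfl
  · intro t; simp only [c5]; exact (hes t).symm

theorem conj_of_free {X : Type*} [TopologicalSpace X] {x y : X} (γ : Path x x) (δ : Path y y)
    (F : (γ : C(I, X)).Homotopy (δ : C(I, X))) (hF : ∀ s, F (s, 0) = F (s, 1)) :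
    ∃ α : Path x y, (γ.trans α).Homotopic (α.trans δ) := by
  let α : Path x y := (F.evalAt 0).cast (by simp) (by simp)
  obtain ⟨K⟩ := Path.Homotopic.map_trans_evalAt F (Path.id)
  refine ⟨α, ⟨(K.pathCast (by simp) (by simp)).cast ?_ ?_⟩⟩
  · ext t
    simp [Path.trans_apply, α, hF, ContinuousMap.Homotopy.evalAt]
  · ext t
    simp [Path.trans_apply, α, ContinuousMap.Homotopy.evalAt]

theorem pi1_Cx (x : {z : ℂ // z ≠ 0}) :
    Nonempty (FundamentalGroup {z : ℂ // z ≠ 0} x ≃* Multiplicative ℤ) := by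
  have hp := Complex.isAddQuotientCoveringMap_exp
  have e := hp.fundamentalGroupEquiv (x := x) ⟨Complex.log x, Subtype.ext (Complex.exp_log x.2)⟩
  have inj : Function.Injective fun k : ℤ => k • (2 * Real.pi * Complex.I : ℂ) :=
    smul_left_injective ℤ Complex.two_pi_I_ne_zero
  let f : ℤ →+ AddSubgroup.zmultiples (2 * Real.pi * Complex.I : ℂ) :=
    (zmultiplesHom _) ⟨2 * Real.pi * Complex.I, AddSubgroup.mem_zmultiples _⟩
  have hf : Function.Bijective f := by
    constructor
    · intro a b h
      apply inj
      simpa [f, Subtype.ext_iff] using h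
    · rintro ⟨z, k, rfl⟩
      exact ⟨k, by simp [f, Subtype.ext_iff]⟩
  let g := (AddEquiv.ofBijective f hf).symm
  exact ⟨(e.trans MulOpposite.opMulEquiv.symm).trans g.toMultiplicative⟩

theorem pi1_of_retract {X : Type*} [TopologicalSpace X] (f : C(X, {z : ℂ // z ≠ 0}))
    (ι : C({z : ℂ // z ≠ 0}, X)) (hfι : ∀ z, f (ι z) = z)
    (h : ∀ γ : C(I, X), γ 0 = γ 1 → FH Set.univ γ (ι.comp (f.comp γ))) :
    PathConnectedSpace X ∧ ∀ q, Nonempty (FundamentalGroup X q ≃* Multiplicative ℤ) := by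
  have hCx : PathConnectedSpace {z : ℂ // z ≠ 0} :=
    isPathConnected_iff_pathConnectedSpace.1
      (isPathConnected_compl_singleton_of_one_lt_rank (by simp) (0 : ℂ))
  have hj : ∀ x : X, Joined x (ι (f x)) := by
    intro x
    obtain ⟨H, c1, -, -, c4, c5⟩ := (h (ContinuousMap.const _ x) rfl).exists_map
    exact ⟨⟨⟨fun s => H (s, 0), by fun_prop⟩, by simp [c4], by simp [c5]⟩⟩
  have hpc : PathConnectedSpace X := by
    refine ⟨⟨ι ⟨1, one_ne_zero⟩⟩, fun x y => ?_⟩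
    refine (hj x).trans (Joined.trans ?_ (hj y).symm)
    exact (PathConnectedSpace.joined (f x) (f y)).map ι.continuous
  refine ⟨hpc, fun q => ?_⟩
  let o : {z : ℂ // z ≠ 0} := ⟨1, one_ne_zero⟩
  obtain ⟨e⟩ := pi1_Cx (f (ι o))
  have hb : Function.Bijective (FundamentalGroup.map f (ι o)) := by
    constructor
    · rw [injective_iff_map_eq_one]
      intro p hp
      obtain ⟨γ, rfl⟩ := Path.Homotopic.Quotient.mk_surjective p
      have hp' : (γ.map f.continuous).Homotopic (Path.refl _) :=
        Path.Homotopic.Quotient.eq.1 hp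
      have h1 : ((γ.map f.continuous).map ι.continuous).Homotopic (Path.refl _) :=
        hp'.map ι
      obtain ⟨F⟩ := h γ (by simp)
      obtain ⟨α, hα⟩ := conj_of_free γ ((γ.map f.continuous).map ι.continuous) F.toHomotopy
        (fun s => (F.prop s).2)
      have h2 : (γ.trans α).Homotopic α :=
        (hα.trans (Path.Homotopic.hcomp (Path.Homotopic.refl α) h1)).trans
          ⟨Path.Homotopy.transRefl α⟩
      have h3 : γ.Homotopic (Path.refl _) := by
        have a1 : γ.Homotopic ((γ.trans α).trans α.symm) :=
          (Path.Homotopic.symm ⟨Path.Homotopy.transRefl γ⟩).trans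
            ((Path.Homotopic.hcomp (Path.Homotopic.refl γ)
              ⟨Path.Homotopy.reflTransSymm α⟩).trans
              (Path.Homotopic.symm ⟨Path.Homotopy.transAssoc γ α α.symm⟩))
        exact (a1.trans (Path.Homotopic.hcomp h2 (Path.Homotopic.refl _))).trans
          (Path.Homotopic.symm ⟨Path.Homotopy.reflTransSymm α⟩)
      exact Path.Homotopic.Quotient.eq.2 h3
    · intro p
      obtain ⟨β, rfl⟩ := Path.Homotopic.Quotient.mk_surjective p
      refine ⟨Path.Homotopic.Quotient.mk ((β.cast (hfι o).symm (hfι o).symm).map ι.continuous), ?_⟩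
      change Path.Homotopic.Quotient.mk (((β.cast (hfι o).symm (hfι o).symm).map ι.continuous).map
        f.continuous) = _
      congr 1
      ext t
      simp [hfι]
  exact ⟨((FundamentalGroup.fundamentalGroupMulEquivOfPathConnected q (ι o)).trans
    (MulEquiv.ofBijective _ hb)).trans e⟩

theorem exists_frame (n : ℕ) (p : Fin (n + 1) → ℂ) (hp : p ≠ 0) :
    ∃ M N : Matrix (Fin (n + 1)) (Fin (n + 1)) ℂ, M * N = 1 ∧ N * M = 1 ∧
      M *ᵥ (Pi.single 0 1) = p := by
  obtain ⟨A, hA⟩ := SeparatingDual.exists_continuousLinearEquiv_apply_eq (R := ℂ)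
    (x := (Pi.single 0 1 : Fin (n + 1) → ℂ)) (y := p) (by simp) hp
  let L : (Fin (n + 1) → ℂ) ≃ₗ[ℂ] (Fin (n + 1) → ℂ) := A.toLinearEquiv
  refine ⟨LinearMap.toMatrix' L.toLinearMap, LinearMap.toMatrix' L.symm.toLinearMap, ?_, ?_, ?_⟩
  · rw [← LinearMap.toMatrix'_comp]; simp
  · rw [← LinearMap.toMatrix'_comp]; simp
  · rw [LinearMap.toMatrix'_mulVec]; exact hA

/-- The condition defining the space in the main theorem. -/
abbrev QP (n : ℕ) (p : Fin (n + 1) → ℂ) (A : Matrix (Fin (n + 1)) (Fin (n + 1)) ℂ) : Prop :=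
  A.IsSymm ∧ A.det ≠ 0 ∧ p ⬝ᵥ A.mulVec p ≠ 0

theorem frame_entry (n : ℕ) (p : Fin (n + 1) → ℂ) (M : Matrix (Fin (n + 1)) (Fin (n + 1)) ℂ)
    (hM : M *ᵥ (Pi.single 0 1) = p) (A : Matrix (Fin (n + 1)) (Fin (n + 1)) ℂ) :
    (Mᵀ * A * M) 0 0 = p ⬝ᵥ A *ᵥ p := by
  rw [← hM, dotProduct_comm, ← dotProduct_transpose_mulVec, mulVec_mulVec, mulVec_mulVec]
  simp [Matrix.mul_assoc]

theorem quadrics_main (n : ℕ) (hn : 1 ≤ n) (p : Fin (n + 1) → ℂ) (hp : p ≠ 0) :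
    PathConnectedSpace (MatQuot (n + 1) (QP n p)) ∧
    ∀ q : MatQuot (n + 1) (QP n p),
      Nonempty (FundamentalGroup (MatQuot (n + 1) (QP n p)) q ≃* Multiplicative ℤ) := by
  obtain ⟨M, N, hMN, hNM, hM⟩ := exists_frame n p hp
  have hMdet : M.det ≠ 0 := by
    intro h
    have := congrArg det hMN
    simp [h] at this
  have hNdet : N.det ≠ 0 := by
    intro h
    have := congrArg det hMN
    simp [h] at this
  have hMNt : Nᵀ * Mᵀ = 1 := by rw [← transpose_mul, hMN, transpose_one]
  have hNMt : Mᵀ * Nᵀ = 1 := by rw [← transpose_mul, hNM, transpose_one]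
  let l : Fin (n + 1) := Fin.last n
  have hl : l ≠ 0 := by
    intro h
    have := congrArg Fin.val h
    simp [l] at this
    omega
  let nrm : {A // QP n p A} → Matrix (Fin (n + 1)) (Fin (n + 1)) ℂ := fun A =>
    (p ⬝ᵥ A.1 *ᵥ p)⁻¹ • (Mᵀ * A.1 * M)
  have hnrm_c : Continuous nrm := by
    have h1 : Continuous fun A : {A // QP n p A} => p ⬝ᵥ A.1 *ᵥ p := by fun_prop
    exact (h1.inv₀ fun A => A.2.2.2).smul (by fun_prop)
  have hnrm_mem : ∀ A, nrm A ∈ NS (0 : Fin (n + 1)) := by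
    intro A
    refine ⟨?_, ?_, ?_⟩
    · refine IsSymm.smul ?_ _
      simp only [IsSymm, transpose_mul, transpose_transpose, A.2.1.eq, Matrix.mul_assoc]
    · simp only [nrm, det_smul, det_mul, det_transpose]
      exact mul_ne_zero (pow_ne_zero _ (inv_ne_zero A.2.2.2))
        (mul_ne_zero (mul_ne_zero hMdet A.2.2.1) hMdet)
    · simp only [nrm, Matrix.smul_apply, frame_entry n p M hM, smul_eq_mul]
      exact inv_mul_cancel₀ A.2.2.2
  let sec : MatQuot (n + 1) (QP n p) → Matrix (Fin (n + 1)) (Fin (n + 1)) ℂ :=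
    Quotient.lift nrm (by
      rintro A B ⟨c, hc⟩
      have hc0 : (c : ℂ) ≠ 0 := c.ne_zero
      have := A.2.2.2
      simp only [nrm, hc, smul_mulVec, dotProduct_smul, Matrix.mul_smul, Matrix.smul_mul,
        smul_smul, smul_eq_mul]
      congr 1
      field_simp)
  have hsecc : Continuous sec := hnrm_c.quotient_lift _
  have hsec_mem : ∀ x, sec x ∈ NS (0 : Fin (n + 1)) := by
    intro x
    induction x using Quotient.inductionOn with
    | h A => exact hnrm_mem A
  have back : ∀ B, Mᵀ * (Nᵀ * B * N) * M = B := by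
    intro B
    calc Mᵀ * (Nᵀ * B * N) * M = (Mᵀ * Nᵀ) * B * (N * M) := by simp only [Matrix.mul_assoc]
      _ = B := by rw [hNMt, hNM, one_mul, mul_one]
  have forth : ∀ B, Nᵀ * (Mᵀ * B * M) * N = B := by
    intro B
    calc Nᵀ * (Mᵀ * B * M) * N = (Nᵀ * Mᵀ) * B * (M * N) := by simp only [Matrix.mul_assoc]
      _ = B := by rw [hMNt, hMN, one_mul, mul_one]
  have hentry : ∀ B : Matrix (Fin (n + 1)) (Fin (n + 1)) ℂ, B 0 0 = 1 →
      p ⬝ᵥ (Nᵀ * B * N) *ᵥ p = 1 := by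
    intro B hB
    rw [← frame_entry n p M hM, back, hB]
  let β₀ : NS (0 : Fin (n + 1)) → {A // QP n p A} := fun B => ⟨Nᵀ * B.1 * N, by
    refine ⟨?_, ?_, ?_⟩
    · simp only [IsSymm, transpose_mul, transpose_transpose, B.2.1.eq, Matrix.mul_assoc]
    · simp only [det_mul, det_transpose]
      exact mul_ne_zero (mul_ne_zero hNdet B.2.2.1) hNdet
    · rw [hentry _ B.2.2.2]; exact one_ne_zero⟩
  have hβ₀ : Continuous β₀ := by
    refine Continuous.subtype_mk ?_ _
    fun_prop
  let β : NS (0 : Fin (n + 1)) → MatQuot (n + 1) (QP n p) := fun B => Quotient.mk _ (β₀ B)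
  have hβ : Continuous β := continuous_quotient_mk'.comp hβ₀
  have hsecβ : ∀ B, sec (β B) = B.1 := by
    intro B
    change (p ⬝ᵥ (Nᵀ * B.1 * N) *ᵥ p)⁻¹ • (Mᵀ * (Nᵀ * B.1 * N) * M) = B.1
    rw [hentry _ B.2.2.2, back, inv_one, one_smul]
  have hβsec : ∀ x, β ⟨sec x, hsec_mem x⟩ = x := by
    intro x
    induction x using Quotient.inductionOn with
    | h A =>
      refine Eq.symm (Quotient.sound (s := scalingSetoid (n + 1) (QP n p))
        ⟨(Units.mk0 _ A.2.2.2)⁻¹, ?_⟩)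
      change Nᵀ * ((p ⬝ᵥ A.1 *ᵥ p)⁻¹ • (Mᵀ * A.1 * M)) * N = _
      rw [Matrix.mul_smul, Matrix.smul_mul, forth]
      simp
  let f : C(MatQuot (n + 1) (QP n p), {z : ℂ // z ≠ 0}) :=
    ⟨fun x => ⟨(sec x).det, (hsec_mem x).2.1⟩, by
      refine Continuous.subtype_mk ?_ _
      exact hsecc.matrix_det⟩
  let ι : C({z : ℂ // z ≠ 0}, MatQuot (n + 1) (QP n p)) :=
    ⟨fun z => β ⟨sdiag l z.1, sdiag_mem 0 l hl _ z.2⟩, by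
      refine hβ.comp (Continuous.subtype_mk ?_ _)
      exact (continuous_sdiag l).comp continuous_subtype_val⟩
  refine pi1_of_retract f ι ?_ ?_
  · intro z
    apply Subtype.ext
    change (sec (β _)).det = z.1
    rw [hsecβ, sdiag_det]
  · intro γ hγ
    have hF := loop_normal_form 0 l hl ⟨fun t => sec (γ t), by fun_prop⟩ (fun t => hsec_mem _)
      (by simp [hγ])
    obtain ⟨H, c1, c2, c3, c4, c5⟩ := hF.exists_map
    refine FH.of (fun z => β ⟨H z, c2 z.1 z.2⟩) (hβ.comp (Continuous.subtype_mk c1 _))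
      (fun _ _ => trivial) ?_ ?_ ?_
    · intro s; simp only [c3]
    · intro t; simp only [c4]; exact hβsec _
    · intro t; simp only [c5]; rfl

end Helpers

/-- For `n ≥ 1` and a nonzero `p ∈ ℂ^{n+1}`, the space `Qu₀(n) ∖ H_p` of nonsingular
quadrics in `ℂPⁿ` not passing through `p` is path-connected with fundamental group `ℤ`
at any basepoint. -/
theorem nonsingular_quadrics_minus_hyperplane_pi1
    (n : ℕ) (hn : 1 ≤ n) (p : Fin (n + 1) → ℂ) (hp : p ≠ 0) :
    PathConnectedSpace
      (MatQuot (n + 1) (fun A => A.IsSymm ∧ A.det ≠ 0 ∧ p ⬝ᵥ A.mulVec p ≠ 0)) ∧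
    ∀ q : MatQuot (n + 1) (fun A => A.IsSymm ∧ A.det ≠ 0 ∧ p ⬝ᵥ A.mulVec p ≠ 0),
      Nonempty
        (FundamentalGroup
            (MatQuot (n + 1) (fun A => A.IsSymm ∧ A.det ≠ 0 ∧ p ⬝ᵥ A.mulVec p ≠ 0)) q
          ≃* Multiplicative ℤ) := by
  exact quadrics_main n hn p hp
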